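/- Let T₁ and T₂ be bounded self-adjoint operators on a separable Hilbert space H. The ranges of T₁ and T₂ coincide if and only if there exist constants 0 < γ ≤ Γ such that γ‖T₁ f‖ ≤ ‖T₂ f‖ ≤ Γ‖T₁ f‖ for all f ∈ H. -/

import Mathlib

open scoped InnerProductSpace in
/-- One half of the Douglas range inclusion theorem: an inclusion of ranges bounds the adjoints. -/
theorem exists_norm_adjoint_le_of_range_subset {𝕜 E F G : Type*} [RCLike 𝕜]
    [NormedAddCommGroup E] [InnerProductSpace 𝕜 E] [CompleteSpace E]
    [NormedAddCommGroup F] [InnerProductSpace 𝕜 F] [CompleteSpace F]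
    [NormedAddCommGroup G] [InnerProductSpace 𝕜 G] [CompleteSpace G]
    (A : E →L[𝕜] F) (B : G →L[𝕜] F) (h : Set.range A ⊆ Set.range B) :
    ∃ C : ℝ, ∀ f : F, ‖A.adjoint f‖ ≤ C * ‖B.adjoint f‖ := by
  have key (x : E) : ∃ y : G, ∀ f : F, ⟪A.adjoint f, x⟫_𝕜 = ⟪B.adjoint f, y⟫_𝕜 := by
    obtain ⟨y, hy⟩ := h ⟨x, rfl⟩
    exact ⟨y, fun f ↦ by simp only [ContinuousLinearMap.adjoint_inner_left, hy]⟩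
  obtain ⟨C, hC⟩ := banach_steinhaus
    (g := fun f : {f : F // ‖B.adjoint f‖ ≤ 1} ↦ innerSL 𝕜 (A.adjoint f)) (fun x ↦ by
      obtain ⟨y, hy⟩ := key x
      refine ⟨‖y‖, fun f ↦ ?_⟩
      rw [innerSL_apply_apply, hy]
      exact (norm_inner_le_norm _ _).trans (mul_le_of_le_one_left (norm_nonneg y) f.2))
  refine ⟨C, fun f ↦ ?_⟩
  by_cases hf : B.adjoint f = 0
  · obtain ⟨y, hy⟩ := key (A.adjoint f)
    have hA : A.adjoint f = 0 := by
      rw [← inner_self_eq_zero (𝕜 := 𝕜), hy, hf, inner_zero_left]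
    simp [hA, hf]
  · have hpos : 0 < ‖B.adjoint f‖ := norm_pos_iff.mpr hf
    have hbound := hC ⟨((‖B.adjoint f‖⁻¹ : ℝ) : 𝕜) • f, by
      rw [map_smul, norm_smul, RCLike.norm_ofReal, abs_of_pos (inv_pos.mpr hpos),
        inv_mul_cancel₀ hpos.ne']⟩
    rwa [innerSL_apply_norm, map_smul, norm_smul, RCLike.norm_ofReal,
      abs_of_pos (inv_pos.mpr hpos), inv_mul_le_iff₀ hpos, mul_comm] at hbound

open scoped InnerProductSpace in
/-- One half of the Douglas range inclusion theorem: a bound on the adjoints gives an inclusion of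
ranges. -/
theorem range_subset_of_norm_adjoint_le {𝕜 E F G : Type*} [RCLike 𝕜]
    [NormedAddCommGroup E] [InnerProductSpace 𝕜 E] [CompleteSpace E]
    [NormedAddCommGroup F] [InnerProductSpace 𝕜 F] [CompleteSpace F]
    [NormedAddCommGroup G] [InnerProductSpace 𝕜 G] [CompleteSpace G]
    (A : E →L[𝕜] F) (B : G →L[𝕜] F) (C : ℝ)
    (h : ∀ f : F, ‖A.adjoint f‖ ≤ C * ‖B.adjoint f‖) : Set.range A ⊆ Set.range B := by
  rintro _ ⟨x, rfl⟩
  have hbound : ∃ C : ℝ, ∀ f : F,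
      ‖(innerSL 𝕜 (A x)).toLinearMap f‖ ≤ C * ‖B.adjoint.toLinearMap f‖ := by
    refine ⟨‖x‖ * C, fun f ↦ ?_⟩
    rw [ContinuousLinearMap.coe_coe, innerSL_apply_apply,
      ← ContinuousLinearMap.adjoint_inner_right, mul_assoc]
    exact (norm_inner_le_norm _ _).trans (mul_le_mul_of_nonneg_left (h f) (norm_nonneg x))
  obtain ⟨φ, hφ, -⟩ := exists_extension_norm_eq _
    ((innerSL 𝕜 (A x)).toLinearMap.compLeftInverse B.adjoint.toLinearMap)
  refine ⟨(InnerProductSpace.toDual 𝕜 G).symm φ, ext_inner_right 𝕜 fun f ↦ ?_⟩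
  rw [← ContinuousLinearMap.adjoint_inner_right, InnerProductSpace.toDual_symm_apply]
  exact (hφ ⟨B.adjoint f, f, rfl⟩).trans
    (LinearMap.compLeftInverse_apply_of_bdd _ _ hbound f _ rfl)

/-- Two bounded self-adjoint operators on a separable Hilbert space have coinciding
ranges iff their norms `‖T₁ f‖` and `‖T₂ f‖` are equivalent. -/
theorem range_eq_iff_norm_equiv
    {H : Type*} [NormedAddCommGroup H] [InnerProductSpace ℂ H] [CompleteSpace H]
    [TopologicalSpace.SeparableSpace H]
    (T₁ T₂ : H →L[ℂ] H) (h₁ : IsSelfAdjoint T₁) (h₂ : IsSelfAdjoint T₂) :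
    Set.range T₁ = Set.range T₂ ↔
      ∃ γ Γ : ℝ, 0 < γ ∧ γ ≤ Γ ∧
        ∀ f : H, γ * ‖T₁ f‖ ≤ ‖T₂ f‖ ∧ ‖T₂ f‖ ≤ Γ * ‖T₁ f‖ := by
  constructor
  · intro h
    obtain ⟨C, hC⟩ := exists_norm_adjoint_le_of_range_subset T₁ T₂ h.subset
    obtain ⟨D, hD⟩ := exists_norm_adjoint_le_of_range_subset T₂ T₁ h.superset
    rw [h₁.adjoint_eq, h₂.adjoint_eq] at hC hD
    have hC₁ : 0 < max C 1 := lt_max_of_lt_right one_pos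
    refine ⟨(max C 1)⁻¹, max D 1, inv_pos.mpr hC₁,
      (inv_le_one_of_one_le₀ (le_max_right C 1)).trans (le_max_right D 1), fun f ↦ ⟨?_, ?_⟩⟩
    · rw [inv_mul_le_iff₀ hC₁]
      exact (hC f).trans (mul_le_mul_of_nonneg_right (le_max_left C 1) (norm_nonneg _))
    · exact (hD f).trans (mul_le_mul_of_nonneg_right (le_max_left D 1) (norm_nonneg _))
  · rintro ⟨γ, Γ, hγ, -, h⟩
    apply Set.Subset.antisymm
    · refine range_subset_of_norm_adjoint_le T₁ T₂ γ⁻¹ fun f ↦ ?_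
      rw [h₁.adjoint_eq, h₂.adjoint_eq, le_inv_mul_iff₀ hγ]
      exact (h f).1
    · refine range_subset_of_norm_adjoint_le T₂ T₁ Γ fun f ↦ ?_
      rw [h₁.adjoint_eq, h₂.adjoint_eq]
      exact (h f).2
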